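/- Let R : A × B → [0,1] be a fuzzy context over the Gödel frame that is ⊤-normalized by rows, and let (g, f) ∈ F_N. Then the possibility and necessity images of g coincide: g^{↑π} = g^{↑N} = f. -/

import Mathlib

open unitInterval

instance : Fact ((0:ℝ) ≤ 1) := ⟨zero_le_one⟩

/-- The Gödel implication on the unit interval: `z ← y = 1` if `y ≤ z`, and `z`
otherwise. -/
noncomputable def gImp (z y : unitInterval) : unitInterval :=
  if y ≤ z then 1 else z

/-- Gödel necessity operator `g^{↑N}(a) = ⨅_{b} (g b ← R a b)`. -/
noncomputable def gUpN {A B : Type*} (R : A → B → unitInterval)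
    (g : B → unitInterval) : A → unitInterval :=
  fun a => ⨅ b, gImp (g b) (R a b)

/-- Gödel necessity operator `f^{↓N}(b) = ⨅_{a} (f a ← R a b)`. -/
noncomputable def gDownN {A B : Type*} (R : A → B → unitInterval)
    (f : A → unitInterval) : B → unitInterval :=
  fun b => ⨅ a, gImp (f a) (R a b)

/-- Gödel possibility operator `g^{↑π}(a) = ⨆_{b} min (R a b) (g b)`. -/
noncomputable def gUpPi {A B : Type*} (R : A → B → unitInterval)
    (g : B → unitInterval) : A → unitInterval :=
  fun a => ⨆ b, R a b ⊓ g b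

/-- Gödel derivation operator `g^↑(a) = ⨅_{b} (R a b ← g b)`. -/
noncomputable def gUp {A B : Type*} (R : A → B → unitInterval)
    (g : B → unitInterval) : A → unitInterval :=
  fun a => ⨅ b, gImp (R a b) (g b)

/-- Gödel derivation operator `f^↓(b) = ⨅_{a} (R a b ← f a)`. -/
noncomputable def gDown {A B : Type*} (R : A → B → unitInterval)
    (f : A → unitInterval) : B → unitInterval :=
  fun b => ⨅ a, gImp (R a b) (f a)

/-- A fuzzy context is `⊤`-normalized by rows if every attribute attains the value `1`
at some object. -/
def TopNormalizedRows {A B : Type*} (R : A → B → unitInterval) : Prop :=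
  ∀ a, ∃ b, R a b = 1

theorem le_gImp_iff {x y z : unitInterval} : x ≤ gImp z y ↔ x ⊓ y ≤ z := by
  unfold gImp
  split_ifs with h
  · exact ⟨fun _ => inf_le_right.trans h, fun _ => unitInterval.le_one'⟩
  · exact ⟨inf_le_left.trans, fun hx => (inf_le_iff.mp hx).resolve_right h⟩

theorem gUpPi_gDownN_le {A B : Type*} (R : A → B → unitInterval) (f : A → unitInterval) :
    gUpPi R (gDownN R f) ≤ f := fun a => iSup_le fun b => by
  rw [inf_comm, ← le_gImp_iff]
  exact iInf_le (fun a => gImp (f a) (R a b)) a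

theorem gUpN_le_gUpPi {A B : Type*} {R : A → B → unitInterval}
    (hR : TopNormalizedRows R) (g : B → unitInterval) : gUpN R g ≤ gUpPi R g := fun a => by
  obtain ⟨b, hb⟩ := hR a
  have h : gUpN R g a ≤ g b := by
    simpa [gUpN, hb, unitInterval.le_one'] using
      le_gImp_iff.mp (iInf_le (fun b => gImp (g b) (R a b)) b)
  exact (le_inf (hb ▸ unitInterval.le_one') h).trans (le_iSup (fun b => R a b ⊓ g b) b)

/-- Over the Gödel frame, for a `⊤`-normalized (by rows) context and `(g, f) ∈ F_N`,
the possibility and necessity images of `g` coincide: `g^{↑π} = g^{↑N} = f`. -/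
theorem gUpPi_eq_gUpN {A B : Type*} (R : A → B → unitInterval)
    (hTN : TopNormalizedRows R) (g : B → unitInterval) (f : A → unitInterval)
    (h1 : gUpN R g = f) (h2 : gDownN R f = g) :
    gUpPi R g = gUpN R g ∧ gUpN R g = f := by
  refine ⟨le_antisymm ?_ (gUpN_le_gUpPi hTN g), h1⟩
  rw [h1, ← h2]
  exact gUpPi_gDownN_le R f
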